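/- arXiv:2503.15612 — 6 statements merged into one kernel-verified Lean document; each statement's English description precedes it below -/
import Mathlib

section
/- Let ι be a nonempty finite index type, f : ι → ℝ, and λ > 0. Set Z = Σ_x exp(−λ f x) and let τ be the Gibbs probability vector τ x = exp(−λ f x)/Z, and assume Σ_x τ x * f x = 0. Then for every probability vector p on ι: (a) Σ_x p x * f x ≤ 0 if and only if −Σ_x p x * log(τ x) ≤ −Σ_x τ x * log(τ x); and (b) Σ_x p x * f x = 0 if and only if −Σ_x p x * log(τ x) = −Σ_x τ x * log(τ x). (Informational form of linear constraints: the linear constraint with MaxEnt prior τ is equivalent to the cross-entropy constraint S(p;τ) ≤ S(τ).) -/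
open Real Finset

/-- Informational form of linear constraints: for the Gibbs prior `τ` associated to a
linear constraint `⟨f⟩ = 0`, the linear constraint on a probability vector `p` is
equivalent to the cross-entropy constraint `S(p;τ) ≤ S(τ)` (and likewise for equalities). -/
theorem informational_form_of_linear_constraints
    {ι : Type*} [Fintype ι] [Nonempty ι] (f : ι → ℝ) (lam : ℝ) (hlam : 0 < lam)
    (Z : ℝ) (hZ : Z = ∑ x, Real.exp (-lam * f x))
    (τ : ι → ℝ) (hτ : ∀ x, τ x = Real.exp (-lam * f x) / Z)
    (hmean : ∑ x, τ x * f x = 0)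
    (p : ι → ℝ) (hp0 : ∀ x, 0 ≤ p x) (hp1 : ∑ x, p x = 1) :
    ((∑ x, p x * f x ≤ 0 ↔
        -∑ x, p x * Real.log (τ x) ≤ -∑ x, τ x * Real.log (τ x)) ∧
     (∑ x, p x * f x = 0 ↔
        -∑ x, p x * Real.log (τ x) = -∑ x, τ x * Real.log (τ x))) := by
  have hZpos : 0 < Z := by
    rw [hZ]
    exact Finset.sum_pos (fun x _ => Real.exp_pos _) Finset.univ_nonempty
  have hlog : ∀ x, Real.log (τ x) = -lam * f x - Real.log Z := fun x => by
    rw [hτ, Real.log_div (Real.exp_ne_zero _) hZpos.ne', Real.log_exp]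
  have hτ1 : ∑ x, τ x = 1 := by
    simp_rw [hτ]
    rw [← Finset.sum_div, ← hZ, div_self hZpos.ne']
  have hcross : ∀ q : ι → ℝ, ∑ x, q x = 1 →
      -∑ x, q x * Real.log (τ x) = lam * ∑ x, q x * f x + Real.log Z := fun q hq => by
    have hsum : ∑ x, q x * Real.log (τ x)
        = -lam * ∑ x, q x * f x - (∑ x, q x) * Real.log Z := by
      rw [Finset.mul_sum, Finset.sum_mul, ← Finset.sum_sub_distrib]
      refine Finset.sum_congr rfl fun x _ => ?_
      rw [hlog]
      ring
    rw [hsum, hq]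
    ring
  rw [hcross p hp1, hcross τ hτ1, hmean, add_le_add_iff_right, add_left_inj,
    mul_le_mul_iff_right₀ hlam, mul_right_inj' hlam.ne']
  exact ⟨Iff.rfl, Iff.rfl⟩
end

section
/- Lower bound of observational entropy by the entropy of the microstate (classical case): let ι, κ be finite types, let r and t be probability vectors on ι with t x > 0 for all x, and assume the constraint −Σ_x r x * log(t x) ≤ H(t). Let Λ : κ → ι → ℝ be a stochastic matrix (Λ y x ≥ 0 and Σ_y Λ y x = 1 for each x), and let p y = Σ_x Λ y x * r x and q y = Σ_x Λ y x * t x be the measured distributions. Then the observational entropy satisfies H(t) − D(p‖q) ≥ H(r). -/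
open Real Finset

/-- The **log-sum inequality** over a finset. -/
theorem sum_mul_log_sum_div_sum_le {α : Type*} (s : Finset α) (a b : α → ℝ)
    (ha : ∀ i ∈ s, 0 ≤ a i) (hb : ∀ i ∈ s, 0 ≤ b i) (hab : ∀ i ∈ s, b i = 0 → a i = 0) :
    (∑ i ∈ s, a i) * Real.log ((∑ i ∈ s, a i) / ∑ i ∈ s, b i) ≤
      ∑ i ∈ s, a i * Real.log (a i / b i) := by
  set A := ∑ i ∈ s, a i with hA
  set B := ∑ i ∈ s, b i with hB
  have tangent : ∀ i ∈ s, a i - b i * (A / B) ≤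
      a i * Real.log (a i / b i) - a i * Real.log (A / B) := by
    intro i hi
    have hA0 : 0 ≤ A := Finset.sum_nonneg ha
    have hB0 : 0 ≤ B := Finset.sum_nonneg hb
    rcases (ha i hi).eq_or_lt with h0 | hai
    · have := mul_nonneg (hb i hi) (div_nonneg hA0 hB0)
      simp only [← h0, zero_mul]
      linarith
    · have hbi : 0 < b i := lt_of_le_of_ne (hb i hi) fun h => hai.ne' (hab i hi h.symm)
      have hA1 : 0 < A := hai.trans_le (Finset.single_le_sum ha hi)
      have hB1 : 0 < B := hbi.trans_le (Finset.single_le_sum hb hi)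
      have hc : 0 < A / B := div_pos hA1 hB1
      have hlog := Real.log_le_sub_one_of_pos (div_pos hc (div_pos hai hbi))
      rw [Real.log_div hc.ne' (div_pos hai hbi).ne'] at hlog
      have hmul := mul_le_mul_of_nonneg_left hlog hai.le
      have hsimp : a i * (A / B / (a i / b i) - 1) = b i * (A / B) - a i := by
        field_simp
      linarith
  have hsum := Finset.sum_le_sum tangent
  rw [Finset.sum_sub_distrib, Finset.sum_sub_distrib, ← Finset.sum_mul, ← Finset.sum_mul,
    ← hA, ← hB] at hsum
  have hle : B * (A / B) = A := mul_div_cancel_of_imp' fun h =>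
    Finset.sum_eq_zero fun i hi => hab i hi ((Finset.sum_eq_zero_iff_of_nonneg hb).1 h i hi)
  linarith

/-- Lower bound of observational entropy by the entropy of the microstate
(classical case): if `r` obeys the cross-entropy constraint associated to the prior `t`,
and `Λ` is a stochastic matrix inducing measured distributions `p`, `q` from `r`, `t`,
then `S = H(t) − D(p‖q) ≥ H(r)`. -/
theorem observational_entropy_ge_microstate_entropy
    {ι κ : Type*} [Fintype ι] [Fintype κ]
    (r t : ι → ℝ)
    (hr0 : ∀ x, 0 ≤ r x) (hr1 : ∑ x, r x = 1)
    (ht0 : ∀ x, 0 < t x) (ht1 : ∑ x, t x = 1)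
    (hconstraint : -∑ x, r x * Real.log (t x) ≤ -∑ x, t x * Real.log (t x))
    (Λ : κ → ι → ℝ) (hΛ0 : ∀ y x, 0 ≤ Λ y x) (hΛ1 : ∀ x, ∑ y, Λ y x = 1)
    (p q : κ → ℝ)
    (hp : ∀ y, p y = ∑ x, Λ y x * r x)
    (hq : ∀ y, q y = ∑ x, Λ y x * t x) :
    (-∑ x, t x * Real.log (t x)) - (∑ y, p y * Real.log (p y / q y)) ≥
      -∑ x, r x * Real.log (r x) := by
  have hdpi : ∑ y, p y * Real.log (p y / q y) ≤ ∑ x, r x * Real.log (r x / t x) := by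
    calc ∑ y, p y * Real.log (p y / q y)
        ≤ ∑ y, ∑ x, Λ y x * (r x * Real.log (r x / t x)) := by
          refine Finset.sum_le_sum fun y _ => ?_
          rw [hp, hq]
          refine (sum_mul_log_sum_div_sum_le _ _ _
            (fun x _ => mul_nonneg (hΛ0 y x) (hr0 x))
            (fun x _ => mul_nonneg (hΛ0 y x) (ht0 x).le) fun x _ h => ?_).trans_eq ?_
          · simp [(mul_eq_zero.1 h).resolve_right (ht0 x).ne']
          · refine Finset.sum_congr rfl fun x _ => ?_
            rcases eq_or_ne (Λ y x) 0 with h | h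
            · simp [h]
            · rw [mul_div_mul_left _ _ h, mul_assoc]
      _ = ∑ x, r x * Real.log (r x / t x) := by
          rw [Finset.sum_comm]
          exact Finset.sum_congr rfl fun x _ => by rw [← Finset.sum_mul, hΛ1, one_mul]
  have hsplit : ∑ x, r x * Real.log (r x / t x) =
      ∑ x, r x * Real.log (r x) - ∑ x, r x * Real.log (t x) := by
    rw [← Finset.sum_sub_distrib]
    refine Finset.sum_congr rfl fun x _ => ?_
    rcases eq_or_ne (r x) 0 with h | h
    · simp [h]
    · rw [Real.log_div h (ht0 x).ne', mul_sub]
  linarith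
end

section
/- Averaged equilibration bound from trace-distance closeness: let ι be a nonempty finite type with m = card ι, let κ be a finite type, w : κ → ℝ a probability vector of weights, (p_k) a family of probability vectors on ι, and q x = Σ_k w k * p_k x the mixture. For each k let s_k = (1/2) Σ_x |p_k x − q x| be the total variation distance, and set ε = Σ_k w k * s_k. Then Σ_k w k * D(p_k‖q) ≤ ε * log m + g(ε), where g(ε) = −ε * log ε + (1 + ε) * log(1 + ε). -/
open Real Finset

/-- If `p ≤ 1`, the relative-entropy density of `p` with respect to `q + δ` is controlled by the
positive part of `p - q`. -/
lemma mul_log_div_add_le {p q δ : ℝ} (hp : 0 ≤ p) (hp1 : p ≤ 1) (hq : 0 ≤ q) (hδ : 0 < δ) :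
    p * Real.log (p / (q + δ)) ≤ (|p - q| + (p - q)) / 2 * (-Real.log δ) := by
  have hR : 0 < q + δ := by linarith
  rcases le_or_gt p q with h | h
  · rw [abs_of_nonpos (by linarith)]
    have hlog : Real.log (p / (q + δ)) ≤ 0 :=
      Real.log_nonpos (by positivity) ((div_le_one hR).2 (by linarith))
    nlinarith
  · rw [abs_of_pos (by linarith)]
    have hp' : 0 < p := by linarith
    obtain ⟨e, rfl⟩ : ∃ e, p = q + e := ⟨p - q, by ring⟩
    have he : 0 < e := by linarith
    have h1 := Real.log_le_sub_one_of_pos (div_pos hp' hR)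
    have h2 := Real.log_le_sub_one_of_pos (mul_pos (div_pos hp' hR) (div_pos hδ he))
    rw [Real.log_mul (div_pos hp' hR).ne' (div_pos hδ he).ne', Real.log_div hδ.ne' he.ne'] at h2
    have h3 := mul_le_mul_of_nonneg_left h1 hq
    have h4 := mul_le_mul_of_nonneg_left h2 he.le
    have h5 : q * ((q + e) / (q + δ) - 1) + e * ((q + e) / (q + δ) * (δ / e) - 1) = 0 := by
      field_simp
      ring
    have h6 : e * Real.log e ≤ 0 :=
      mul_nonpos_of_nonneg_of_nonpos he.le (Real.log_nonpos he.le (by linarith))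
    linarith

/-- The tangent-line bound for the logarithm of a likelihood ratio with respect to a measure `R`
of total mass `c`. -/
lemma mul_log_div_le {q R c : ℝ} (hq : 0 ≤ q) (hR : 0 < R) (hc : 0 < c) :
    q * Real.log (R / q) ≤ q * Real.log c + R / c - q := by
  rcases hq.eq_or_lt with rfl | hq
  · simp only [zero_mul, zero_add, sub_zero]
    positivity
  · have h1 := Real.log_le_sub_one_of_pos (div_pos (div_pos hR hq) hc)
    rw [Real.log_div (div_pos hR hq).ne' hc.ne'] at h1
    have h2 := mul_le_mul_of_nonneg_left h1 hq.le
    have h3 : q * (R / q / c - 1) = R / c - q := by field_simp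
    linarith

/-- Averaged equilibration bound from trace-distance closeness: with
`q = Σ_k w_k p_k` the mixture, `s_k` the total-variation distance of `p_k` to `q`,
and `ε = Σ_k w_k s_k`, one has
`Σ_k w_k D(p_k‖q) ≤ ε log m + g(ε)` where `g(ε) = −ε log ε + (1+ε) log(1+ε)`. -/
theorem averaged_equilibration_bound
    {ι κ : Type*} [Fintype ι] [Nonempty ι] [Fintype κ]
    (m : ℕ) (hm : m = Fintype.card ι)
    (w : κ → ℝ) (hw0 : ∀ k, 0 ≤ w k) (hw1 : ∑ k, w k = 1)
    (p : κ → ι → ℝ) (hp0 : ∀ k x, 0 ≤ p k x) (hp1 : ∀ k, ∑ x, p k x = 1)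
    (q : ι → ℝ) (hq : ∀ x, q x = ∑ k, w k * p k x)
    (s : κ → ℝ) (hs : ∀ k, s k = (1 / 2) * ∑ x, |p k x - q x|)
    (ε : ℝ) (hε : ε = ∑ k, w k * s k) :
    ∑ k, w k * ∑ x, p k x * Real.log (p k x / q x) ≤
      ε * Real.log m + (-ε * Real.log ε + (1 + ε) * Real.log (1 + ε)) := by
  have hm0 : (0 : ℝ) < m := by
    rw [hm]
    exact_mod_cast Fintype.card_pos
  have hwp (k : κ) (x : ι) : 0 ≤ w k * p k x := mul_nonneg (hw0 k) (hp0 k x)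
  have hq0 (x : ι) : 0 ≤ q x := by
    rw [hq]
    exact Finset.sum_nonneg fun k _ => hwp k x
  have hq1 : ∑ x, q x = 1 := by
    simp_rw [hq]
    rw [Finset.sum_comm]
    simp_rw [← Finset.mul_sum, hp1, mul_one, hw1]
  have hs0 (k : κ) : 0 ≤ s k := by
    rw [hs]
    positivity
  have hws (k : κ) : 0 ≤ w k * s k := mul_nonneg (hw0 k) (hs0 k)
  have hε0 : 0 ≤ ε := by
    rw [hε]
    exact Finset.sum_nonneg fun k _ => hws k
  rcases hε0.eq_or_lt with h0 | hpos
  · have hzero := (Finset.sum_eq_zero_iff_of_nonneg fun k _ => hws k).1 (hε.symm.trans h0.symm)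
    have hlhs : ∑ k, w k * ∑ x, p k x * Real.log (p k x / q x) = 0 := by
      refine Finset.sum_eq_zero fun k _ => ?_
      rcases mul_eq_zero.1 (hzero k (Finset.mem_univ k)) with h | h
      · rw [h, zero_mul]
      · have habs : ∑ x, |p k x - q x| = 0 := by
          have := hs k
          linarith
        have heq := (Finset.sum_eq_zero_iff_of_nonneg fun x _ => abs_nonneg (p k x - q x)).1 habs
        refine mul_eq_zero_of_right _ (Finset.sum_eq_zero fun x hx => ?_)
        rw [sub_eq_zero.1 (abs_eq_zero.1 (heq x hx))]
        by_cases hqx : q x = 0 <;> simp [hqx]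
    rw [hlhs, ← h0]
    simp
  · have hδ : 0 < ε / m := div_pos hpos hm0
    have hR (x : ι) : 0 < q x + ε / m := add_pos_of_nonneg_of_pos (hq0 x) hδ
    have hp_le (k : κ) (x : ι) : p k x ≤ 1 :=
      (hp1 k) ▸ Finset.single_le_sum (fun y _ => hp0 k y) (Finset.mem_univ x)
    have hsplit (k : κ) (x : ι) : w k * (p k x * Real.log (p k x / q x)) =
        w k * (p k x * Real.log (p k x / (q x + ε / m))) +
          w k * p k x * Real.log ((q x + ε / m) / q x) := by
      rcases (hwp k x).eq_or_lt with h | h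
      · rw [← mul_assoc, ← mul_assoc, ← h]
        simp
      · have hpx : p k x ≠ 0 := right_ne_zero_of_mul h.ne'
        have hqx : 0 < q x := by
          rw [hq]
          exact h.trans_le
            (Finset.single_le_sum (fun j _ => hwp j x) (Finset.mem_univ k))
        rw [Real.log_div hpx hqx.ne', Real.log_div hpx (hR x).ne',
          Real.log_div (hR x).ne' hqx.ne']
        ring
    have hdecomp : ∑ k, w k * ∑ x, p k x * Real.log (p k x / q x) =
        ∑ k, w k * ∑ x, p k x * Real.log (p k x / (q x + ε / m)) +
          ∑ x, q x * Real.log ((q x + ε / m) / q x) := by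
      simp_rw [Finset.mul_sum, hsplit, Finset.sum_add_distrib]
      congr 1
      rw [Finset.sum_comm]
      refine Finset.sum_congr rfl fun x _ => ?_
      rw [← Finset.sum_mul, ← hq]
    have hfirst : ∑ k, w k * ∑ x, p k x * Real.log (p k x / (q x + ε / m)) ≤
        ε * (-Real.log (ε / m)) := by
      rw [hε, Finset.sum_mul, ← hε]
      refine Finset.sum_le_sum fun k _ => ?_
      rw [mul_assoc]
      refine mul_le_mul_of_nonneg_left ?_ (hw0 k)
      calc ∑ x, p k x * Real.log (p k x / (q x + ε / m))
          ≤ ∑ x, (|p k x - q x| + (p k x - q x)) / 2 * (-Real.log (ε / m)) :=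
            Finset.sum_le_sum fun x _ =>
              mul_log_div_add_le (hp0 k x) (hp_le k x) (hq0 x) hδ
        _ = s k * (-Real.log (ε / m)) := by
            rw [← Finset.sum_mul, ← Finset.sum_div, Finset.sum_add_distrib,
              Finset.sum_sub_distrib, hp1, hq1, hs]
            ring
    have hsecond : ∑ x, q x * Real.log ((q x + ε / m) / q x) ≤ Real.log (1 + ε) := by
      calc ∑ x, q x * Real.log ((q x + ε / m) / q x)
          ≤ ∑ x, (q x * Real.log (1 + ε) + (q x + ε / m) / (1 + ε) - q x) :=
            Finset.sum_le_sum fun x _ => mul_log_div_le (hq0 x) (hR x) (by linarith)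
        _ = Real.log (1 + ε) := by
            rw [Finset.sum_sub_distrib, Finset.sum_add_distrib, ← Finset.sum_mul,
              ← Finset.sum_div, Finset.sum_add_distrib, hq1, Finset.sum_const,
              Finset.card_univ, ← hm, nsmul_eq_mul]
            field_simp
            ring
    have hlog : 0 ≤ ε * Real.log (1 + ε) := mul_nonneg hε0 (Real.log_nonneg (by linarith))
    rw [Real.log_div hpos.ne' hm0.ne'] at hfirst
    rw [hdecomp]
    linarith
end

section
/- Entropy production identity for master-equation dynamics with local detailed balance: let ι be a finite type, R : ι → ι → ℝ a rate matrix with R x x' ≥ 0 for all x ≠ x' and Σ_x R x x' = 0 for every x', let p and q be probability vectors on ι with p x > 0 and q x > 0 for all x, and assume local detailed balance: R x x' * q x' = R x' x * q x for all x, x'. Then Σ_x (Σ_{x'} R x x' * p x') * (log(q x) − log(p x)) = Σ_x Σ_{x'} R x x' * p x' * log((R x x' * p x') / (R x' x * p x)), where terms are interpreted with the conventions 0/0 = 0 and log 0 = 0. -/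
open Real Finset

/-- Under local detailed balance the logarithmic ratio of forward and backward fluxes is a
difference of potentials `log q - log p`. -/
theorem flux_mul_log_flux_ratio {a b p p' q q' : ℝ} (hp : 0 < p) (hp' : 0 < p')
    (hq : 0 < q) (hq' : 0 < q') (h : a * q' = b * q) :
    a * p' * Real.log ((a * p') / (b * p)) =
      a * p' * (Real.log q - Real.log p) - a * (p' * (Real.log q' - Real.log p')) := by
  rcases eq_or_ne a 0 with rfl | ha
  · simp
  have hb : b ≠ 0 := by
    rintro rfl
    simp [ha, hq'.ne'] at h
  have hratio : (a * p') / (b * p) = (q * p') / (q' * p) := by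
    rw [div_eq_div_iff (by positivity) (by positivity)]
    linear_combination p * p' * h
  rw [hratio, Real.log_div (by positivity) (by positivity),
    Real.log_mul hq.ne' hp'.ne', Real.log_mul hq'.ne' hp.ne']
  ring

/-- Entropy production identity for master-equation dynamics with local detailed
balance: the time derivative of observational entropy,
`Σ_x (Σ_{x'} R_{xx'} p_{x'}) (log q_x − log p_x)`, equals the
stochastic-thermodynamic entropy production
`Σ_{x,x'} R_{xx'} p_{x'} log(R_{xx'} p_{x'} / (R_{x'x} p_x))`
(with Lean's conventions `0/0 = 0` and `log 0 = 0`). -/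
theorem entropy_production_identity
    {ι : Type*} [Fintype ι] [DecidableEq ι]
    (R : ι → ι → ℝ) (hRoff : ∀ x x', x ≠ x' → 0 ≤ R x x')
    (hRsum : ∀ x', ∑ x, R x x' = 0)
    (p q : ι → ℝ)
    (hp0 : ∀ x, 0 < p x) (hp1 : ∑ x, p x = 1)
    (hq0 : ∀ x, 0 < q x) (hq1 : ∑ x, q x = 1)
    (hLDB : ∀ x x', R x x' * q x' = R x' x * q x) :
    ∑ x, (∑ x', R x x' * p x') * (Real.log (q x) - Real.log (p x)) =
      ∑ x, ∑ x', R x x' * p x' * Real.log ((R x x' * p x') / (R x' x * p x)) := by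
  have hcol : ∑ x, ∑ x', R x x' * (p x' * (Real.log (q x') - Real.log (p x'))) = 0 := by
    rw [Finset.sum_comm]
    simp [← Finset.sum_mul, hRsum]
  simp_rw [fun x x' => flux_mul_log_flux_ratio (hp0 x) (hp0 x') (hq0 x) (hq0 x') (hLDB x x'),
    Finset.sum_sub_distrib, hcol, sub_zero, Finset.sum_mul]
end

section
/- Nonnegativity of entropy production under local detailed balance: let ι be a finite type, R : ι → ι → ℝ with R x x' ≥ 0 for all x ≠ x', let p and q be probability vectors on ι with p x > 0 and q x > 0 for all x, and assume local detailed balance: R x x' * q x' = R x' x * q x for all x, x'. Then Σ_x Σ_{x'} R x x' * p x' * log((R x x' * p x') / (R x' x * p x)) ≥ 0, where terms are interpreted with the conventions 0/0 = 0 and log 0 = 0. Consequently observational entropy is nondecreasing along master-equation dynamics satisfying local detailed balance. -/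
open Real Finset

/-- The symmetrized entropy flow between two nonnegative currents is nonnegative. -/
lemma mul_log_div_add_mul_log_div_nonneg {a b : ℝ} (ha : 0 ≤ a) (hb : 0 ≤ b) :
    0 ≤ a * Real.log (a / b) + b * Real.log (b / a) := by
  rcases ha.eq_or_lt with rfl | ha
  · simp
  rcases hb.eq_or_lt with rfl | hb
  · simp
  rw [Real.log_div ha.ne' hb.ne', Real.log_div hb.ne' ha.ne']
  rcases le_total a b with h | h
  · nlinarith [Real.log_le_log ha h]
  · nlinarith [Real.log_le_log hb h]

/-- Nonnegativity of entropy production under local detailed balance: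
`Σ_{x,x'} R_{xx'} p_{x'} log(R_{xx'} p_{x'} / (R_{x'x} p_x)) ≥ 0`
(with Lean's conventions `0/0 = 0` and `log 0 = 0`); hence observational
entropy is nondecreasing along master-equation dynamics with local
detailed balance. -/
theorem entropy_production_nonneg
    {ι : Type*} [Fintype ι] [DecidableEq ι]
    (R : ι → ι → ℝ) (hRoff : ∀ x x', x ≠ x' → 0 ≤ R x x')
    (p q : ι → ℝ)
    (hp0 : ∀ x, 0 < p x) (hp1 : ∑ x, p x = 1)
    (hq0 : ∀ x, 0 < q x) (hq1 : ∑ x, q x = 1)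
    (hLDB : ∀ x x', R x x' * q x' = R x' x * q x) :
    0 ≤ ∑ x, ∑ x', R x x' * p x' * Real.log ((R x x' * p x') / (R x' x * p x)) := by
  have hsymm : ∑ x, ∑ x', R x x' * p x' * Real.log ((R x x' * p x') / (R x' x * p x)) =
      ∑ x, ∑ x', R x' x * p x * Real.log ((R x' x * p x) / (R x x' * p x')) :=
    Finset.sum_comm
  have hsum : 0 ≤ ∑ x, ∑ x',
      (R x x' * p x' * Real.log ((R x x' * p x') / (R x' x * p x)) +
        R x' x * p x * Real.log ((R x' x * p x) / (R x x' * p x'))) := by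
    refine Finset.sum_nonneg fun x _ => Finset.sum_nonneg fun x' _ => ?_
    rcases eq_or_ne x x' with rfl | hne
    · rcases eq_or_ne (R x x * p x) 0 with h | h <;> simp [h]
    · exact mul_log_div_add_mul_log_div_nonneg
        (mul_nonneg (hRoff x x' hne) (hp0 x').le)
        (mul_nonneg (hRoff x' x hne.symm) (hp0 x).le)
  simp only [Finset.sum_add_distrib] at hsum
  linarith
end

section
/- Observational entropy of a mixture decomposes into the average observational entropy plus a mutual information: let ι and κ be finite types, λ : κ → ℝ a probability vector of weights, (p^k) a family of probability vectors on ι, V : ι → ℝ with V x > 0 for all x, and let p x = Σ_k λ k * p^k x be the mixture. Define the mutual information I = Σ_x Σ_k λ k * p^k x * log((λ k * p^k x) / (p x * λ k)). Then −Σ_x p x * log(p x / V x) = Σ_k λ k * (−Σ_x p^k x * log(p^k x / V x)) + I, where terms are interpreted with the conventions 0/0 = 0, log 0 = 0 and 0·log 0 = 0. -/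
open Real Finset

/-- Observational entropy of a mixture decomposes as the average observational
entropy of the components plus the mutual information between measurement
outcomes and the ensemble label:
`S_M^τ(Σ_k λ_k ρ_k) = Σ_k λ_k S_M^τ(ρ_k) + I(M : ℰ)`. -/
theorem observational_entropy_mixture_decomposition
    {ι κ : Type*} [Fintype ι] [Fintype κ]
    (lam : κ → ℝ) (hlam0 : ∀ k, 0 ≤ lam k) (hlam1 : ∑ k, lam k = 1)
    (pk : κ → ι → ℝ) (hpk0 : ∀ k x, 0 ≤ pk k x) (hpk1 : ∀ k, ∑ x, pk k x = 1)
    (V : ι → ℝ) (hV : ∀ x, 0 < V x)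
    (p : ι → ℝ) (hp : ∀ x, p x = ∑ k, lam k * pk k x)
    (I : ℝ)
    (hI : I = ∑ x, ∑ k, lam k * pk k x *
        Real.log ((lam k * pk k x) / (p x * lam k))) :
    -∑ x, p x * Real.log (p x / V x) =
      (∑ k, lam k * (-∑ x, pk k x * Real.log (pk k x / V x))) + I := by
  have key : ∀ x k, lam k * pk k x * Real.log (p x / V x) =
      lam k * (pk k x * Real.log (pk k x / V x)) -
        lam k * pk k x * Real.log ((lam k * pk k x) / (p x * lam k)) := by
    intro x k
    rcases (hlam0 k).eq_or_lt with hl | hl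
    · simp [← hl]
    rcases (hpk0 k x).eq_or_lt with hq | hq
    · simp [← hq]
    have hpx : 0 < p x := by
      rw [hp x]
      exact Finset.sum_pos' (fun j _ => mul_nonneg (hlam0 j) (hpk0 j x))
        ⟨k, Finset.mem_univ k, mul_pos hl hq⟩
    rw [mul_comm (p x), mul_div_mul_left _ _ hl.ne',
      Real.log_div hpx.ne' (hV x).ne', Real.log_div hq.ne' (hV x).ne',
      Real.log_div hq.ne' hpx.ne']
    ring
  have mixture : ∑ x, p x * Real.log (p x / V x) =
      ∑ x, ∑ k, lam k * pk k x * Real.log (p x / V x) :=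
    Finset.sum_congr rfl fun x _ => by rw [← Finset.sum_mul, ← hp x]
  simp only [mixture, key, Finset.sum_sub_distrib, mul_neg, Finset.sum_neg_distrib,
    Finset.mul_sum, hI]
  rw [Finset.sum_comm (f := fun x k => lam k * (pk k x * Real.log (pk k x / V x)))]
  ring
end
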